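/- arXiv:math/0405360 — 2 statements merged into one kernel-verified Lean document; each statement's English description precedes it below -/
import Mathlib

section
/- Let (X, B, μ) be an atomless standard probability space and let τ₁, τ₂ be aperiodic measure-preserving automorphisms of X. Then for every ε > 0 there exists an invertible measure-preserving transformation γ of X such that, setting τ₂' = γ⁻¹ ∘ τ₂ ∘ γ, one has μ({x : τ₁(x) ≠ τ₂'(x)}) ≤ ε. -/
open MeasureTheory Set

section

open Filter Topology

theorem continuous_measureReal_Iic (ν : Measure ℝ) [IsFiniteMeasure ν]
    [NullSingletonClass ν] : Continuous fun y => ν.real (Iic y) := by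
  have h : (fun y => ν.real (Iic y)) = fun y => ∫ a, (Iic y).indicator (fun _ => (1 : ℝ)) a ∂ν := by
    funext y
    rw [integral_indicator measurableSet_Iic]
    simp
  rw [h, continuous_iff_continuousAt]
  intro y
  refine continuousAt_of_dominated (bound := fun _ => 1) ?_ ?_ (integrable_const _) ?_
  · exact .of_forall fun z =>
      (measurable_const.indicator measurableSet_Iic).aestronglyMeasurable
  · refine .of_forall fun z => .of_forall fun a => ?_
    by_cases ha : a ∈ Iic z <;> simp [ha]
  · filter_upwards [Measure.ae_ne ν y] with a ha
    rcases lt_or_gt_of_ne ha with ha | ha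
    · refine continuousAt_const.congr (f := fun _ => (1 : ℝ)) ?_
      filter_upwards [lt_mem_nhds ha] with z hz
      simp [hz.le]
    · refine continuousAt_const.congr (f := fun _ => (0 : ℝ)) ?_
      filter_upwards [gt_mem_nhds ha] with z hz
      simp [hz]

/-- A finite atomless measure on `ℝ` is pushed to Lebesgue measure by its distribution function. -/
theorem map_measureReal_Iic (ν : Measure ℝ) [IsFiniteMeasure ν] [NullSingletonClass ν] :
    ν.map (fun y => ν.real (Iic y)) = volume.restrict (Icc 0 (ν.real univ)) := by
  set G := fun y => ν.real (Iic y) with hG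
  set m := ν.real univ with hm
  have hcont : Continuous G := continuous_measureReal_Iic ν
  have hmono : Monotone G := fun a b hab => measureReal_mono (Iic_subset_Iic.2 hab)
  have hbot : Tendsto G atBot (𝓝 0) := by
    have h := tendsto_measure_iInter_atBot (μ := ν) (s := fun y : ℝ => Iic y)
      (fun _ => measurableSet_Iic.nullMeasurableSet) (fun a b hab => Iic_subset_Iic.2 hab)
      ⟨0, measure_ne_top _ _⟩
    have h0 : (⋂ y : ℝ, Iic y) = ∅ := by
      ext x
      simpa using exists_lt x
    rw [h0, measure_empty] at h
    exact (ENNReal.tendsto_toReal ENNReal.zero_ne_top).comp h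
  have htop : Tendsto G atTop (𝓝 m) :=
    (ENNReal.tendsto_toReal (measure_ne_top _ _)).comp (tendsto_measure_Iic_atTop ν)
  have hsurj : ∀ s, 0 < s → s < m → ∃ x, G x = s := fun s h0 h1 =>
    mem_range_of_exists_le_of_exists_ge hcont
      ((hbot.eventually_lt_const h0).exists.imp fun _ => le_of_lt)
      ((htop.eventually_const_lt h1).exists.imp fun _ => le_of_lt)
  have hle : ∀ x, G x ≤ m := fun x => measureReal_mono (subset_univ _)
  have h0 : ∀ x, 0 ≤ G x := fun x => measureReal_nonneg
  refine Measure.ext_of_Iic _ _ fun t => ?_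
  rw [Measure.map_apply hcont.measurable measurableSet_Iic,
    Measure.restrict_apply measurableSet_Iic]
  rcases lt_or_ge t 0 with ht | ht
  · have e1 : G ⁻¹' Iic t = ∅ := by
      ext x
      simpa using ht.trans_le (h0 x)
    have e2 : Iic t ∩ Icc 0 m = ∅ := by
      ext x
      simp only [mem_inter_iff, mem_Iic, mem_Icc, mem_empty_iff_false, iff_false]
      rintro ⟨h, h', -⟩
      linarith
    simp [e1, e2]
  rcases le_or_gt m t with hmt | hmt
  · have e1 : G ⁻¹' Iic t = univ := by
      ext x
      simpa using (hle x).trans hmt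
    have e2 : Iic t ∩ Icc 0 m = Icc 0 m := inter_eq_right.2 fun x hx => hx.2.trans hmt
    rw [e1, e2, Real.volume_Icc, sub_zero, hm, ofReal_measureReal]
  have e2 : Iic t ∩ Icc 0 m = Icc 0 t := by
    ext x
    simp only [mem_inter_iff, mem_Iic, mem_Icc]
    exact ⟨fun h => ⟨h.2.1, h.1⟩, fun h => ⟨h.2, h.1, h.2.trans hmt.le⟩⟩
  rw [e2, Real.volume_Icc, sub_zero, ← ofReal_measureReal]
  congr 1
  apply le_antisymm
  · refine le_of_forall_gt_imp_ge_of_dense fun s hs => ?_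
    rcases le_or_gt m s with hms | hms
    · exact (measureReal_mono (subset_univ _)).trans hms
    obtain ⟨x, hx⟩ := hsurj s (ht.trans_lt hs) hms
    rw [← hx]
    refine measureReal_mono fun y hy => ?_
    by_contra hxy
    have h1 : G y ≤ t := hy
    have h2 := hmono (le_of_not_ge hxy)
    linarith
  · rcases ht.eq_or_lt with rfl | ht
    · exact measureReal_nonneg
    obtain ⟨x, hx⟩ := hsurj t ht hmt
    nth_rewrite 1 [← hx]
    exact measureReal_mono fun y hy => (hmono hy).trans hx.le

/-- A finite atomless measure on a standard Borel space is isomorphic modulo null sets to Lebesgue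
measure on an interval. -/
theorem exists_map_eq_restrict_Icc {X : Type*} [MeasurableSpace X] [StandardBorelSpace X]
    (μ : Measure X) [IsFiniteMeasure μ] [NullSingletonClass μ] :
    ∃ (F : X → ℝ) (A : Set X), Measurable F ∧ MeasurableSet A ∧ μ Aᶜ = 0 ∧ InjOn F A ∧
      μ.map F = volume.restrict (Icc 0 (μ.real univ)) := by
  have hf := measurableEmbedding_embeddingReal X
  set f := embeddingReal X
  set ν := μ.map f with hν
  have : NullSingletonClass ν := ⟨fun y => by
    rw [hν, hf.map_apply]
    exact (subsingleton_singleton.preimage hf.injective).measure_zero μ⟩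
  have hmap := map_measureReal_Iic ν
  have hG := (continuous_measureReal_Iic ν).measurable
  have huniv : ν.real univ = μ.real univ := by
    simp [Measure.real, hν, hf.map_apply]
  set G := fun y => ν.real (Iic y) with hGdef
  have hmono : Monotone G := fun a b hab => measureReal_mono (Iic_subset_Iic.2 hab)
  have hmap' : μ.map (G ∘ f) = volume.restrict (Icc 0 (μ.real univ)) := by
    rw [← Measure.map_map hG hf.measurable, ← hν, hmap, huniv]
  have hmeas : ∀ c : ℝ, MeasurableSet ((G ∘ f) ⁻¹' {c}) := fun c =>
    (hG.comp hf.measurable) (measurableSet_singleton c)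
  refine ⟨G ∘ f, ⋂ q : ℚ, ((G ∘ f) ⁻¹' {G q})ᶜ, hG.comp hf.measurable,
    .iInter fun q => (hmeas _).compl, ?_, ?_, hmap'⟩
  · simp only [compl_iInter, compl_compl]
    refine measure_iUnion_null fun q => ?_
    rw [← Measure.map_apply (hG.comp hf.measurable) (measurableSet_singleton _), hmap']
    exact measure_singleton _
  · have key : ∀ x y, (∀ q : ℚ, G (f x) ≠ G q) → f x < f y → G (f x) ≠ G (f y) := by
      intro x y hx hxy h
      obtain ⟨q, hq1, hq2⟩ := exists_rat_btwn hxy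
      exact hx q (le_antisymm (hmono hq1.le) (h ▸ hmono hq2.le))
    intro x hx y hy hxy
    simp only [mem_iInter, mem_compl_iff, mem_preimage, mem_singleton_iff,
      Function.comp_apply] at hx hy hxy
    by_contra hne
    rcases lt_or_gt_of_ne (hf.injective.ne hne) with h | h
    · exact key x y hx h hxy
    · exact key y x hy h hxy.symm

theorem exists_measurableSet_uncountable_null {X : Type*} [MeasurableSpace X] [StandardBorelSpace X]
    (μ : Measure X) [IsFiniteMeasure μ]
    {A : Set X} (hA : MeasurableSet A) (hAc : ¬ A.Countable) :
    ∃ Z ⊆ A, MeasurableSet Z ∧ ¬ Z.Countable ∧ μ Z = 0 := by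
  have := hA.standardBorel
  have hR : ¬ Countable (ℝ × ℝ) := fun h =>
    Cardinal.not_countable_real
      ((countable_univ_iff.2 (Function.Injective.countable (f := fun x : ℝ => (x, x))
        fun x y h => (Prod.ext_iff.1 h).1)))
  let e : A ≃ᵐ ℝ × ℝ := PolishSpace.measurableEquivOfNotCountable (by simpa using hAc) hR
  let Z : ℝ → Set X := fun a => Subtype.val '' (e ⁻¹' ({a} ×ˢ univ))
  have hZ : ∀ a, MeasurableSet (Z a) := fun a =>
    hA.subtype_image (e.measurable ((measurableSet_singleton a).prod .univ))
  have hdisj : Pairwise (Function.onFun Disjoint Z) := by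
    intro a b hab
    refine Set.disjoint_left.2 ?_
    rintro _ ⟨x, hx, rfl⟩ ⟨y, hy, hxy⟩
    obtain rfl := Subtype.val_injective hxy
    simp only [mem_preimage, mem_prod, mem_singleton_iff, mem_univ, and_true] at hx hy
    exact hab (hx.symm.trans hy)
  have hc := Measure.countable_meas_pos_of_disjoint_iUnion (μ := μ) hZ hdisj
  obtain ⟨a, ha⟩ : ∃ a, ¬ 0 < μ (Z a) := by
    by_contra! h
    exact Cardinal.not_countable_real (by simpa [h] using hc)
  refine ⟨Z a, Subtype.coe_image_subset _ _, hZ a, fun h => ?_, by simpa using ha⟩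
  have h1 : (e ⁻¹' ({a} ×ˢ univ)).Countable :=
    countable_of_injective_of_countable_image Subtype.val_injective.injOn h
  have h2 : (({a} : Set ℝ) ×ˢ (univ : Set ℝ)).Countable := by
    have := h1.image e
    rwa [image_preimage_eq _ e.surjective] at this
  have h3 : (univ : Set ℝ) ⊆ Prod.snd '' (({a} : Set ℝ) ×ˢ (univ : Set ℝ)) :=
    fun x _ => ⟨(a, x), by simp, rfl⟩
  exact Cardinal.not_countable_real ((h2.image Prod.snd).mono h3)

/-- `f` maps `A` bijectively onto `B` with inverse `g`, measurably in both directions, and carries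
the restriction of `μ` to `A` to its restriction to `B`. -/
structure MeasureIsoOn {X : Type*} [MeasurableSpace X]
    (μ : Measure X) (A B : Set X) (f g : X → X) : Prop where
  measurable : Measurable f
  measurable_inv : Measurable g
  mapsTo : MapsTo f A B
  mapsTo_inv : MapsTo g B A
  leftInvOn : LeftInvOn g f A
  rightInvOn : LeftInvOn f g B
  map_restrict : (μ.restrict A).map f = μ.restrict B

theorem MeasureIsoOn.of_equiv {X : Type*} [MeasurableSpace X]
    {μ : Measure X} {A B : Set X} (hA : MeasurableSet A)
    (hB : MeasurableSet B) (e : A ≃ᵐ B)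
    (he : ∀ S, MeasurableSet S → μ (Subtype.val '' {x : A | (e x : X) ∈ S}) = μ (S ∩ B)) :
    ∃ f g, MeasureIsoOn μ A B f g := by
  classical
  refine ⟨fun x => if h : x ∈ A then e ⟨x, h⟩ else x,
    fun x => if h : x ∈ B then e.symm ⟨x, h⟩ else x, ?_⟩
  have hf : Measurable fun x => if h : x ∈ A then (e ⟨x, h⟩ : X) else x :=
    Measurable.dite (f := fun x : A => (e x : X)) (g := fun x : (Aᶜ : Set X) => (x : X))
      (measurable_subtype_coe.comp e.measurable) measurable_subtype_coe hA
  have hg : Measurable fun x => if h : x ∈ B then (e.symm ⟨x, h⟩ : X) else x :=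
    Measurable.dite (f := fun x : B => (e.symm x : X)) (g := fun x : (Bᶜ : Set X) => (x : X))
      (measurable_subtype_coe.comp e.symm.measurable) measurable_subtype_coe hB
  refine ⟨hf, hg, fun x hx => ?_, fun x hx => ?_, fun x hx => ?_, fun x hx => ?_, ?_⟩
  · simp [hx]
  · simp [hx]
  · simp [hx]
  · simp [hx]
  · ext S hS
    rw [Measure.map_apply hf hS, Measure.restrict_apply (hf hS), Measure.restrict_apply hS,
      ← he S hS]
    congr 1
    ext x
    simp only [mem_inter_iff, mem_preimage, mem_image, mem_ofPred_eq, Subtype.exists,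
      exists_and_right, exists_eq_right]
    constructor
    · rintro ⟨h, hx⟩
      exact ⟨hx, by simpa [hx] using h⟩
    · rintro ⟨hx, h⟩
      exact ⟨by simpa [hx] using h, hx⟩

theorem MeasureIsoOn.iUnion {X : Type*} [MeasurableSpace X]
    {ι : Type*} [Countable ι] [Nonempty ι] {μ : Measure X}
    {P Q : ι → Set X} {f g : ι → X → X} (hP : ∀ i, MeasurableSet (P i))
    (hQ : ∀ i, MeasurableSet (Q i)) (hPd : Pairwise (Function.onFun Disjoint P))
    (hQd : Pairwise (Function.onFun Disjoint Q))
    (h : ∀ i, MeasureIsoOn μ (P i) (Q i) (f i) (g i)) :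
    ∃ F G, MeasureIsoOn μ (⋃ i, P i) (⋃ i, Q i) F G ∧ ∀ i, EqOn F (f i) (P i) := by
  have hdisj : ∀ {R : ι → Set X} {u : ι → X → X}, Pairwise (Function.onFun Disjoint R) →
      Pairwise fun i j => EqOn (u i) (u j) (R i ∩ R j) := fun hR i j hij x hx =>
    (Set.disjoint_left.1 (hR hij) hx.1 hx.2).elim
  obtain ⟨F, hF, hFf⟩ := exists_measurable_piecewise P hP f (fun i => (h i).measurable) (hdisj hPd)
  obtain ⟨G, hG, hGg⟩ :=
    exists_measurable_piecewise Q hQ g (fun i => (h i).measurable_inv) (hdisj hQd)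
  refine ⟨F, G, ⟨hF, hG, ?_, ?_, ?_, ?_, ?_⟩, hFf⟩
  · refine mapsTo_iUnion.2 fun i x hx => mem_iUnion.2 ⟨i, ?_⟩
    rw [hFf i hx]
    exact (h i).mapsTo hx
  · refine mapsTo_iUnion.2 fun i x hx => mem_iUnion.2 ⟨i, ?_⟩
    rw [hGg i hx]
    exact (h i).mapsTo_inv hx
  · intro x hx
    obtain ⟨i, hi⟩ := mem_iUnion.1 hx
    rw [hFf i hi, hGg i ((h i).mapsTo hi), (h i).leftInvOn hi]
  · intro x hx
    obtain ⟨i, hi⟩ := mem_iUnion.1 hx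
    rw [hGg i hi, hFf i ((h i).mapsTo_inv hi), (h i).rightInvOn hi]
  · rw [Measure.restrict_iUnion hPd hP, Measure.restrict_iUnion hQd hQ,
      Measure.map_sum hF.aemeasurable]
    congr 1
    funext i
    rw [← (h i).map_restrict]
    refine Measure.map_congr ?_
    filter_upwards [ae_restrict_mem (hP i)] with x hx using hFf i hx

theorem exists_injOn_map_restrict_eq {X : Type*} [MeasurableSpace X] [StandardBorelSpace X]
    (μ : Measure X) [IsFiniteMeasure μ] [NullSingletonClass μ]
    {A : Set X} (hA : MeasurableSet A) (hA0 : μ A ≠ 0) :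
    ∃ (F : X → ℝ) (A' : Set X), Measurable F ∧ MeasurableSet A' ∧ A' ⊆ A ∧ μ (A \ A') = 0 ∧
      ¬ (A \ A').Countable ∧ InjOn F A' ∧
      (μ.restrict A).map F = volume.restrict (Icc 0 (μ.real A)) := by
  obtain ⟨F, A₁, hF, hA₁, hA₁c, hinj, hmap⟩ := exists_map_eq_restrict_Icc (μ.restrict A)
  obtain ⟨Z, hZA, hZ, hZc, hZ0⟩ := exists_measurableSet_uncountable_null μ hA
    fun h => hA0 (h.measure_zero μ)
  have hZd : Z ⊆ A \ ((A ∩ A₁) \ Z) := fun x hx => ⟨hZA hx, fun h' => h'.2 hx⟩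
  refine ⟨F, (A ∩ A₁) \ Z, hF, (hA.inter hA₁).diff hZ, fun x hx => hx.1.1, ?_,
    fun h => hZc (h.mono hZd),
    hinj.mono fun x hx => hx.1.2, by simpa [Measure.real] using hmap⟩
  rw [Measure.restrict_apply hA₁.compl] at hA₁c
  refine measure_mono_null (t := (A₁ᶜ ∩ A) ∪ Z) (fun x hx => ?_) (measure_union_null hA₁c hZ0)
  by_cases hxZ : x ∈ Z
  · exact .inr hxZ
  · exact .inl ⟨fun h => hx.2 ⟨⟨hx.1, h⟩, hxZ⟩, hx.1⟩

theorem MeasureIsoOn.of_injOn {X : Type*} [MeasurableSpace X] [StandardBorelSpace X]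
    {μ : Measure X} {A B : Set X} (hA : MeasurableSet A)
    (hB : MeasurableSet B) {F G : X → ℝ} (hF : Measurable F) (hG : Measurable G)
    (hFi : InjOn F A) (hGi : InjOn G B) (hFG : F '' A = G '' B)
    (hmap : (μ.restrict A).map F = (μ.restrict B).map G) :
    ∃ f g, MeasureIsoOn μ A B f g := by
  have := hA.standardBorel
  have := hB.standardBorel
  have hF' : MeasurableEmbedding (A.domRestrict F) :=
    (hF.comp measurable_subtype_coe).measurableEmbedding (injOn_iff_injective.1 hFi)
  have hG' : MeasurableEmbedding (B.domRestrict G) :=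
    (hG.comp measurable_subtype_coe).measurableEmbedding (injOn_iff_injective.1 hGi)
  have hr : range (A.domRestrict F) = range (B.domRestrict G) := by
    rwa [range_domRestrict, range_domRestrict]
  let c : range (A.domRestrict F) ≃ᵐ range (B.domRestrict G) :=
    { toEquiv := Equiv.setCongr hr
      measurable_toFun := measurable_subtype_coe.subtype_mk
      measurable_invFun := measurable_subtype_coe.subtype_mk }
  let e : A ≃ᵐ B := (hF'.equivRange.trans c).trans hG'.equivRange.symm
  have he : ∀ x : A, G (e x) = F x := fun x => by
    have h : hG'.equivRange (e x) = c (hF'.equivRange x) := hG'.equivRange.apply_symm_apply _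
    rw [hG'.equivRange_apply, hF'.equivRange_apply] at h
    exact congrArg Subtype.val h
  refine MeasureIsoOn.of_equiv hA hB e fun S hS => ?_
  have hI : MeasurableSet (G '' (S ∩ B)) :=
    (hS.inter hB).image_of_measurable_injOn hG (hGi.mono inter_subset_right)
  have h := congrArg (fun ν : Measure ℝ => ν (G '' (S ∩ B))) hmap
  simp only [Measure.map_apply hF hI, Measure.map_apply hG hI, Measure.restrict_apply (hF hI),
    Measure.restrict_apply (hG hI)] at h
  convert h using 2
  · ext x
    simp only [mem_image, mem_ofPred_eq, Subtype.exists, exists_and_right, exists_eq_right,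
      mem_inter_iff, mem_preimage]
    constructor
    · rintro ⟨hx, h⟩
      exact ⟨⟨_, ⟨h, (e ⟨x, hx⟩).2⟩, he ⟨x, hx⟩⟩, hx⟩
    · rintro ⟨⟨y, hy, hyx⟩, hx⟩
      refine ⟨hx, ?_⟩
      rw [← hGi hy.2 (e ⟨x, hx⟩).2 (hyx.trans (he ⟨x, hx⟩).symm)]
      exact hy.1
  · ext x
    simp only [mem_inter_iff, mem_preimage, mem_image]
    constructor
    · exact fun hx => ⟨⟨x, hx, rfl⟩, hx.2⟩
    · rintro ⟨⟨y, hy, hyx⟩, hx⟩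
      rw [← hGi hy.2 hx hyx]
      exact hy

/-- Measurable sets of equal positive measure are isomorphic, with no exceptional null sets. -/
theorem MeasureIsoOn.exists_of_measure_eq {X : Type*} [MeasurableSpace X] [StandardBorelSpace X]
    (μ : Measure X) [IsFiniteMeasure μ]
    [NullSingletonClass μ] {A B : Set X} (hA : MeasurableSet A) (hB : MeasurableSet B)
    (hAB : μ A = μ B) (hA0 : μ A ≠ 0) : ∃ f g, MeasureIsoOn μ A B f g := by
  obtain ⟨F, A₁, hF, hA₁, hA₁A, hA₁0, hA₁c, hFi, hFm⟩ := exists_injOn_map_restrict_eq μ hA hA0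
  obtain ⟨G, B₁, hG, hB₁, hB₁B, hB₁0, hB₁c, hGi, hGm⟩ :=
    exists_injOn_map_restrict_eq μ hB (hAB ▸ hA0)
  have hm : μ.real A = μ.real B := by simp [Measure.real, hAB]
  rw [← hm] at hGm
  set lam := (volume : Measure ℝ).restrict (Icc 0 (μ.real A))
  have null_image : ∀ {A A₁ : Set X} {F : X → ℝ}, MeasurableSet A₁ → Measurable F →
      InjOn F A₁ → μ (A \ A₁) = 0 → (μ.restrict A).map F = lam → lam (F '' A₁)ᶜ = 0 := by
    intro A A₁ F hA₁ hF hFi h0 hFm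
    have hI := hA₁.image_of_measurable_injOn hF hFi
    rw [← hFm, Measure.map_apply hF hI.compl, Measure.restrict_apply (hF hI.compl)]
    exact measure_mono_null (t := A \ A₁) (fun x hx => ⟨hx.2, fun h => hx.1 ⟨x, h, rfl⟩⟩) h0
  have null_diff : ∀ {A A₁ : Set X} {F : X → ℝ} {C : Set ℝ}, MeasurableSet C → Measurable F →
      μ (A \ A₁) = 0 → (μ.restrict A).map F = lam → lam Cᶜ = 0 →
      μ (A \ (A₁ ∩ F ⁻¹' C)) = 0 := by
    intro A A₁ F C hC hF h0 hFm hC0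
    rw [← hFm, Measure.map_apply hF hC.compl, Measure.restrict_apply (hF hC.compl)] at hC0
    refine measure_mono_null (fun x hx => ?_) (measure_union_null h0 hC0)
    by_cases h : x ∈ A₁
    · exact .inr ⟨fun hc => hx.2 ⟨h, hc⟩, hx.1⟩
    · exact .inl ⟨hx.1, h⟩
  set C := F '' A₁ ∩ G '' B₁ with hCdef
  have hC : MeasurableSet C :=
    (hA₁.image_of_measurable_injOn hF hFi).inter (hB₁.image_of_measurable_injOn hG hGi)
  have hC0 : lam Cᶜ = 0 := by
    rw [hCdef, compl_inter]
    exact measure_union_null (null_image hA₁ hF hFi hA₁0 hFm) (null_image hB₁ hG hGi hB₁0 hGm)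
  set A₂ := A₁ ∩ F ⁻¹' C
  set B₂ := B₁ ∩ G ⁻¹' C
  have hA₂ : MeasurableSet A₂ := hA₁.inter (hF hC)
  have hB₂ : MeasurableSet B₂ := hB₁.inter (hG hC)
  have hA₂A : A₂ ⊆ A := inter_subset_left.trans hA₁A
  have hB₂B : B₂ ⊆ B := inter_subset_left.trans hB₁B
  have hA₂0 : μ (A \ A₂) = 0 := null_diff hC hF hA₁0 hFm hC0
  have hB₂0 : μ (B \ B₂) = 0 := null_diff hC hG hB₁0 hGm hC0
  have hrA : μ.restrict A₂ = μ.restrict A :=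
    Measure.restrict_congr_set (hA₂A.eventuallyLE.antisymm (ae_le_set.2 hA₂0))
  have hrB : μ.restrict B₂ = μ.restrict B :=
    Measure.restrict_congr_set (hB₂B.eventuallyLE.antisymm (ae_le_set.2 hB₂0))
  obtain ⟨f₁, g₁, h₁⟩ := MeasureIsoOn.of_injOn (μ := μ) hA₂ hB₂ hF hG
    (hFi.mono inter_subset_left) (hGi.mono inter_subset_left)
    (by
      rw [image_inter_preimage, image_inter_preimage, inter_eq_right.2 inter_subset_left,
        inter_eq_right.2 inter_subset_right])
    (by rw [hrA, hrB, hFm, hGm])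
  have hAd : MeasurableSet (A \ A₂) := hA.diff hA₂
  have hBd : MeasurableSet (B \ B₂) := hB.diff hB₂
  have := hAd.standardBorel
  have := hBd.standardBorel
  let e : (A \ A₂ : Set X) ≃ᵐ (B \ B₂ : Set X) := PolishSpace.measurableEquivOfNotCountable
    (fun h => hA₁c ((countable_coe_iff.1 h).mono (sdiff_subset_sdiff_right inter_subset_left)))
    (fun h => hB₁c ((countable_coe_iff.1 h).mono (sdiff_subset_sdiff_right inter_subset_left)))
  obtain ⟨f₂, g₂, h₂⟩ := MeasureIsoOn.of_equiv (μ := μ) hAd hBd e fun S _ => by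
    rw [measure_mono_null (Subtype.coe_image_subset _ _) hA₂0,
      measure_mono_null inter_subset_right hB₂0]
  obtain ⟨f, g, h, -⟩ := MeasureIsoOn.iUnion (μ := μ)
    (P := fun b : Bool => cond b A₂ (A \ A₂)) (Q := fun b : Bool => cond b B₂ (B \ B₂))
    (f := fun b => cond b f₁ f₂) (g := fun b => cond b g₁ g₂)
    (Bool.forall_bool.2 ⟨hAd, hA₂⟩) (Bool.forall_bool.2 ⟨hBd, hB₂⟩)
    (pairwise_disjoint_on_bool.2 disjoint_sdiff_right)
    (pairwise_disjoint_on_bool.2 disjoint_sdiff_right)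
    (Bool.forall_bool.2 ⟨h₂, h₁⟩)
  refine ⟨f, g, ?_⟩
  rwa [← union_eq_iUnion, ← union_eq_iUnion, union_sdiff_cancel hA₂A,
    union_sdiff_cancel hB₂B] at h

theorem MeasureIsoOn.symm {X : Type*} [MeasurableSpace X]
    {μ : Measure X} {A B : Set X} {f g : X → X} (hA : MeasurableSet A)
    (h : MeasureIsoOn μ A B f g) : MeasureIsoOn μ B A g f := by
  refine ⟨h.measurable_inv, h.measurable, h.mapsTo_inv, h.mapsTo, h.rightInvOn, h.leftInvOn, ?_⟩
  rw [← h.map_restrict, Measure.map_map h.measurable_inv h.measurable]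
  conv_rhs => rw [← Measure.map_id (μ := μ.restrict A)]
  refine Measure.map_congr ?_
  filter_upwards [ae_restrict_mem hA] with x hx using h.leftInvOn hx

theorem MeasureIsoOn.trans {X : Type*} [MeasurableSpace X]
    {μ : Measure X} {A B C : Set X} {f g f' g' : X → X}
    (h : MeasureIsoOn μ A B f g) (h' : MeasureIsoOn μ B C f' g') :
    MeasureIsoOn μ A C (f' ∘ f) (g ∘ g') := by
  refine ⟨h'.measurable.comp h.measurable, h.measurable_inv.comp h'.measurable_inv,
    h'.mapsTo.comp h.mapsTo, h.mapsTo_inv.comp h'.mapsTo_inv,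
    fun x hx => ?_, fun x hx => ?_, ?_⟩
  · simp [h'.leftInvOn (h.mapsTo hx), h.leftInvOn hx]
  · simp [h.rightInvOn (h'.mapsTo_inv hx), h'.rightInvOn hx]
  · rw [← Measure.map_map h'.measurable h.measurable, h.map_restrict, h'.map_restrict]

theorem MeasureIsoOn.iterate_symm {X : Type*} [MeasurableSpace X]
    {μ : Measure X} {τ : X ≃ᵐ X} (hτ : MeasurePreserving τ μ μ)
    {E : Set X} (hE : MeasurableSet E) (k : ℕ) :
    MeasureIsoOn μ (τ.symm^[k] ⁻¹' E) E τ.symm^[k] τ^[k] := by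
  have hr : Function.LeftInverse τ.symm^[k] τ^[k] :=
    Function.LeftInverse.iterate τ.left_inv k
  have hl : Function.LeftInverse τ^[k] τ.symm^[k] :=
    Function.LeftInverse.iterate τ.right_inv k
  refine ⟨τ.symm.measurable.iterate k, τ.measurable.iterate k, fun x hx => hx, fun x hx => ?_,
    fun x _ => hl x, fun x _ => hr x, ?_⟩
  · rwa [mem_preimage, hr]
  · exact (((hτ.symm τ).iterate k).restrict_preimage hE).map_eq

theorem exists_subset_measure_eq {X : Type*} [MeasurableSpace X] [StandardBorelSpace X]
    (μ : Measure X) [IsFiniteMeasure μ] [NullSingletonClass μ]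
    {A : Set X} (hA : MeasurableSet A) {c : ENNReal} (hc : c ≤ μ A) :
    ∃ B ⊆ A, MeasurableSet B ∧ μ B = c := by
  obtain ⟨F, -, hF, -, -, -, hmap⟩ := exists_map_eq_restrict_Icc (μ.restrict A)
  refine ⟨F ⁻¹' Iic c.toReal ∩ A, inter_subset_right, (hF measurableSet_Iic).inter hA, ?_⟩
  have hcA : c.toReal ≤ (μ.restrict A).real univ := by
    simpa [Measure.real] using ENNReal.toReal_mono (measure_ne_top μ A) hc
  rw [← Measure.restrict_apply (hF measurableSet_Iic), ← Measure.map_apply hF measurableSet_Iic,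
    hmap, Measure.restrict_apply measurableSet_Iic]
  have e : Iic c.toReal ∩ Icc 0 ((μ.restrict A).real univ) = Icc 0 c.toReal := by
    ext x
    simp only [mem_inter_iff, mem_Iic, mem_Icc]
    exact ⟨fun h => ⟨h.2.1, h.1⟩, fun h => ⟨h.2, h.1, h.2.trans hcA⟩⟩
  rw [e, Real.volume_Icc, sub_zero, ENNReal.ofReal_toReal (hc.trans_lt (measure_lt_top μ A)).ne]

/-- Almost every point lies in one of countably many measurable sets which do not meet their own
first `n - 1` iterated preimages. -/
theorem exists_countable_cover_of_aperiodic {X : Type*} [MeasurableSpace X] [StandardBorelSpace X]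
    {μ : Measure X} {T : X → X} (hT : Measurable T)
    (hper : ∀ n : ℕ, 1 ≤ n → μ {x | T^[n] x = x} = 0) (n : ℕ) :
    ∃ A : ℕ → Set X, (∀ k, MeasurableSet (A k)) ∧ (∀ᵐ x ∂μ, ∃ k, x ∈ A k) ∧
      ∀ k, ∀ x ∈ A k, ∀ j, 1 ≤ j → j < n → T^[j] x ∉ A k := by
  have hf := measurableEmbedding_embeddingReal X
  set f := embeddingReal X
  let S : ℚ × ℕ → Set X := fun p => {x | |f x - p.1| < 1 / (p.2 + 1 : ℝ)} ∩
    ⋂ j ∈ Finset.Ico 1 n, {x | 2 / (p.2 + 1 : ℝ) ≤ |f (T^[j] x) - f x|}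
  have hS : ∀ p, MeasurableSet (S p) := fun p => by
    refine (measurableSet_lt ?_ measurable_const).inter
      (Finset.measurableSet_biInter _ fun j _ => measurableSet_le measurable_const ?_)
    · exact (hf.measurable.sub_const _).abs
    · exact ((hf.measurable.comp (hT.iterate j)).sub hf.measurable).abs
  have hne : ∀ᵐ x ∂μ, ∀ j : ℕ, 1 ≤ j → T^[j] x ≠ x := by
    refine ae_all_iff.2 fun j => ?_
    by_cases hj : 1 ≤ j
    · filter_upwards [measure_eq_zero_iff_ae_notMem.1 (hper j hj)] with x hx _ using hx
    · exact .of_forall fun x h => absurd h hj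
  refine ⟨fun k => S ((Denumerable.eqv (ℚ × ℕ)).symm k), fun k => hS _, ?_, ?_⟩
  · filter_upwards [hne] with x hx
    have hm : ∃ m : ℕ, ∀ j ∈ Finset.Ico 1 n, 2 / (m + 1 : ℝ) ≤ |f (T^[j] x) - f x| := by
      have h : ∀ᶠ m : ℕ in atTop, ∀ j ∈ Finset.Ico 1 n,
          2 / (m + 1 : ℝ) ≤ |f (T^[j] x) - f x| := by
        refine (Filter.eventually_all_finset _).2 fun j hj => ?_
        have hpos : 0 < |f (T^[j] x) - f x| :=
          abs_pos.2 (sub_ne_zero.2 (hf.injective.ne (hx j (Finset.mem_Ico.1 hj).1)))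
        have ht : Tendsto (fun m : ℕ => 2 * (1 / (m + 1 : ℝ))) atTop (𝓝 (2 * 0)) :=
          tendsto_one_div_add_atTop_nhds_zero_nat.const_mul 2
        rw [mul_zero] at ht
        filter_upwards [ht.eventually_lt_const hpos] with m hm
        rw [mul_one_div] at hm
        exact hm.le
      exact h.exists
    obtain ⟨m, hm⟩ := hm
    have hm0 : (0 : ℝ) < 1 / (m + 1) := by positivity
    obtain ⟨q, hq1, hq2⟩ := exists_rat_btwn (lt_add_of_pos_right (f x) hm0)
    refine ⟨Denumerable.eqv (ℚ × ℕ) (q, m), ?_⟩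
    simp only [Equiv.symm_apply_apply]
    refine ⟨?_, by simpa using hm⟩
    show |f x - q| < 1 / (m + 1 : ℝ)
    rw [abs_lt]
    constructor <;> linarith
  · intro k x hx j h1 hj hj'
    set p := (Denumerable.eqv (ℚ × ℕ)).symm k
    have a1 : |f x - p.1| < 1 / (p.2 + 1 : ℝ) := hx.1
    have a2 : |f (T^[j] x) - p.1| < 1 / (p.2 + 1 : ℝ) := hj'.1
    have a3 : 2 / (p.2 + 1 : ℝ) ≤ |f (T^[j] x) - f x| :=
      mem_iInter₂.1 hx.2 j (Finset.mem_Ico.2 ⟨h1, hj⟩)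
    have a4 := abs_sub_le (f (T^[j] x)) p.1 (f x)
    rw [abs_sub_comm (p.1 : ℝ) (f x)] at a4
    have a5 : (2 : ℝ) / (p.2 + 1) = 1 / (p.2 + 1) + 1 / (p.2 + 1) := by ring
    linarith

/-- An aperiodic map has a marker set of measure at most `1 / n` which almost every orbit meets. -/
theorem exists_small_marker {X : Type*} [MeasurableSpace X] [StandardBorelSpace X]
    {μ : Measure X} [IsProbabilityMeasure μ] {T : X → X}
    (hT : MeasurePreserving T μ μ) (hper : ∀ n : ℕ, 1 ≤ n → μ {x | T^[n] x = x} = 0) (n : ℕ) :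
    ∃ B, MeasurableSet B ∧ n * μ B ≤ 1 ∧ ∀ᵐ x ∂μ, ∃ j : ℕ, T^[j] x ∈ B := by
  obtain ⟨A, hA, hcover, hsep⟩ := exists_countable_cover_of_aperiodic hT.measurable hper n
  let D : ℕ → Set X := fun k => ⋃ j : ℕ, T^[j] ⁻¹' A k
  have hD : ∀ k, MeasurableSet (D k) := fun k =>
    .iUnion fun j => hT.measurable.iterate j (hA k)
  have hDmem : ∀ {k x}, x ∈ D k ↔ ∃ j : ℕ, T^[j] x ∈ A k := fun {k x} => by simp [D]
  have hDback : ∀ {k x} (j : ℕ), T^[j] x ∈ D k → x ∈ D k := fun {k x} j h => by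
    obtain ⟨i, hi⟩ := hDmem.1 h
    exact hDmem.2 ⟨i + j, by rwa [Function.iterate_add_apply]⟩
  let B' : ℕ → Set X := fun k => A k \ ⋃ l ∈ Finset.range k, D l
  have hB' : ∀ {k x}, x ∈ B' k ↔ x ∈ A k ∧ ∀ l < k, x ∉ D l := fun {k x} => by simp [B']
  have hB : MeasurableSet (⋃ k, B' k) := .iUnion fun k =>
    (hA k).diff (Finset.measurableSet_biUnion _ fun l _ => hD l)
  refine ⟨⋃ k, B' k, hB, ?_, ?_⟩
  · have hrec : ∀ᵐ x ∂μ, ∀ k, x ∈ A k → ∀ d : ℕ, T^[d] x ∈ D k := by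
      refine ae_all_iff.2 fun k => ?_
      filter_upwards [hT.conservative.ae_mem_imp_frequently_image_mem
        (hA k).nullMeasurableSet] with x hx hxk d
      obtain ⟨i, hi, hi'⟩ := ((hx hxk).and_eventually (eventually_ge_atTop d)).exists
      exact hDmem.2 ⟨i - d, by rwa [← Function.iterate_add_apply, Nat.sub_add_cancel hi']⟩
    have hret : ∀ᵐ x ∂μ, x ∈ ⋃ k, B' k → ∀ d, 1 ≤ d → d < n → T^[d] x ∉ ⋃ k, B' k := by
      filter_upwards [hrec] with x hx hxB d h1 hd hdB
      obtain ⟨k, hk⟩ := mem_iUnion.1 hxB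
      obtain ⟨l, hl⟩ := mem_iUnion.1 hdB
      rw [hB'] at hk hl
      rcases lt_trichotomy k l with h | h | h
      · exact hl.2 k h (hx k hk.1 d)
      · subst h
        exact hsep k x hk.1 d h1 hd hl.1
      · exact hk.2 l h (hDback d (hDmem.2 ⟨0, hl.1⟩))
    set B := ⋃ k, B' k
    have hdisj : ∀ i j : Fin n, i < j → AEDisjoint μ (T^[i] ⁻¹' B) (T^[j] ⁻¹' B) := by
      intro i j hij
      have h := (hT.iterate i).quasiMeasurePreserving.ae hret
      refine measure_eq_zero_iff_ae_notMem.2 ?_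
      filter_upwards [h] with x hx hxB
      have hij' : (i : ℕ) < j := hij
      refine hx hxB.1 (j - i) (by omega) (by omega) ?_
      rw [← Function.iterate_add_apply, Nat.sub_add_cancel hij'.le]
      exact hxB.2
    calc (n : ENNReal) * μ B = ∑ i : Fin n, μ (T^[i] ⁻¹' B) := by
          simp [(hT.iterate _).measure_preimage hB.nullMeasurableSet]
      _ = μ (⋃ i : Fin n, T^[i] ⁻¹' B) := by
          have hpair : Pairwise (Function.onFun (AEDisjoint μ) fun i : Fin n => T^[i] ⁻¹' B) := by
            intro i j hij
            rcases lt_or_gt_of_ne hij with h | h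
            · exact hdisj i j h
            · exact (hdisj j i h).symm
          rw [measure_iUnion₀ hpair
            (fun i => (hT.measurable.iterate i hB).nullMeasurableSet), tsum_fintype]
      _ ≤ 1 := prob_le_one
  · filter_upwards [hcover] with x ⟨k, hk⟩
    classical
    have hex : ∃ k, x ∈ D k := ⟨k, hDmem.2 ⟨0, hk⟩⟩
    obtain ⟨j, hj⟩ := hDmem.1 (Nat.find_spec hex)
    exact ⟨j, mem_iUnion.2 ⟨Nat.find hex, hB'.2 ⟨hj, fun l hl h =>
      Nat.find_min hex hl (hDback j h)⟩⟩⟩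

/-- The Rokhlin lemma for aperiodic, not necessarily ergodic, automorphisms. -/
theorem exists_rokhlin_tower {X : Type*} [MeasurableSpace X] [StandardBorelSpace X]
    {μ : Measure X} [IsProbabilityMeasure μ] {τ : X ≃ᵐ X}
    (hτ : MeasurePreserving τ μ μ) (hper : ∀ n : ℕ, 1 ≤ n → μ {x | τ^[n] x = x} = 0)
    {N : ℕ} (hN : 0 < N) {δ : ENNReal} (hδ : δ ≠ 0) :
    ∃ E, MeasurableSet E ∧ (∀ x ∈ E, ∀ k, 1 ≤ k → k < N → τ^[k] x ∉ E) ∧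
      μ (⋃ k : Fin N, τ.symm^[k] ⁻¹' E)ᶜ ≤ δ := by
  obtain ⟨n, hn⟩ : ∃ n : ℕ, (N : ENNReal) / δ < n :=
    ENNReal.exists_nat_gt (ENNReal.div_lt_top (ENNReal.natCast_ne_top N) hδ).ne
  obtain ⟨B, hB, hBn, hBhit⟩ := exists_small_marker hτ hper n
  let C : ℕ → Set X := fun m => τ^[m] ⁻¹' B \ ⋃ j ∈ Finset.range m, τ^[j] ⁻¹' B
  have hCm : ∀ m, MeasurableSet (C m) := fun m =>
    (τ.measurable.iterate m hB).diff
      (Finset.measurableSet_biUnion _ fun j _ => τ.measurable.iterate j hB)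
  have hC : ∀ {m x}, x ∈ C m ↔ τ^[m] x ∈ B ∧ ∀ j < m, τ^[j] x ∉ B := fun {m x} => by simp [C]
  have hCu : ∀ {m m' x}, x ∈ C m → x ∈ C m' → m = m' := by
    intro m m' x h h'
    rw [hC] at h h'
    rcases lt_trichotomy m m' with hl | hl | hl
    · exact absurd h.1 (h'.2 m hl)
    · exact hl
    · exact absurd h'.1 (h.2 m' hl)
  have hCshift : ∀ {m k x}, x ∈ C (m + k) → τ^[k] x ∈ C m := by
    intro m k x h
    rw [hC] at h ⊢
    refine ⟨by rw [← Function.iterate_add_apply]; exact h.1, fun j hj => ?_⟩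
    rw [← Function.iterate_add_apply]
    exact h.2 _ (by omega)
  have hinv : ∀ k x, τ^[k] (τ.symm^[k] x) = x := fun k =>
    Function.LeftInverse.iterate τ.right_inv k
  refine ⟨⋃ i : ℕ, C (i * N + (N - 1)), .iUnion fun i => hCm _, ?_, ?_⟩
  · intro x hx k h1 hk hkx
    obtain ⟨i, hi⟩ := mem_iUnion.1 hx
    obtain ⟨i', hi'⟩ := mem_iUnion.1 hkx
    rw [show i * N + (N - 1) = (i * N + (N - 1 - k)) + k by omega] at hi
    have h := congrArg (· % N) (hCu (hCshift hi) hi')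
    simp only [Nat.mul_add_mod'] at h
    rw [Nat.mod_eq_of_lt (by omega), Nat.mod_eq_of_lt (by omega)] at h
    omega
  · have hsub : ∀ᵐ x ∂μ, x ∈ (⋃ k : Fin N, τ.symm^[k] ⁻¹' ⋃ i : ℕ, C (i * N + (N - 1)))ᶜ →
        x ∈ ⋃ k : Fin N, τ.symm^[k] ⁻¹' B := by
      filter_upwards [hBhit] with x hhit hx
      classical
      by_contra hxB
      simp only [mem_iUnion, mem_preimage, mem_compl_iff, not_exists] at hx hxB
      set m := Nat.find hhit
      have hm : x ∈ C m := hC.2 ⟨Nat.find_spec hhit, fun j hj => Nat.find_min hhit hj⟩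
      have hlt := Nat.mod_lt m hN
      have hdm := Nat.div_add_mod' m N
      refine hx ⟨N - 1 - m % N, by omega⟩ (m / N) ?_
      simp only
      set k := N - 1 - m % N
      rw [show m / N * N + (N - 1) = m + k by omega, hC]
      have hkm : τ^[m + k] (τ.symm^[k] x) = τ^[m] x := by
        rw [Function.iterate_add_apply, hinv]
      refine ⟨hkm ▸ (hC.1 hm).1, fun j hj => ?_⟩
      rcases lt_or_ge j k with hjk | hjk
      · have e : τ^[j] (τ.symm^[k] x) = τ.symm^[k - j] x := by
          conv_lhs => rw [show k = j + (k - j) by omega, Function.iterate_add_apply, hinv]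
        rw [e]
        exact hxB ⟨k - j, by omega⟩
      · have e : τ^[j] (τ.symm^[k] x) = τ^[j - k] x := by
          conv_lhs => rw [show j = (j - k) + k by omega, Function.iterate_add_apply, hinv]
        rw [e]
        exact (hC.1 hm).2 _ (by omega)
    calc μ (⋃ k : Fin N, τ.symm^[k] ⁻¹' ⋃ i : ℕ, C (i * N + (N - 1)))ᶜ
        ≤ μ (⋃ k : Fin N, τ.symm^[k] ⁻¹' B) := measure_mono_ae hsub
      _ ≤ ∑ k : Fin N, μ (τ.symm^[k] ⁻¹' B) := measure_iUnion_fintype_le _ _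
      _ = N * μ B := by
          simp [((hτ.symm τ).iterate _).measure_preimage hB.nullMeasurableSet]
      _ ≤ δ := by
          have hn0 : (n : ENNReal) ≠ 0 := (bot_le.trans_lt hn).ne'
          have hδn : (N : ENNReal) ≤ n * δ := by
            by_cases hδt : δ = ⊤
            · simp [hδt, hn0]
            · exact (ENNReal.div_le_iff hδ hδt).1 hn.le
          calc N * μ B ≤ n * δ * μ B := by gcongr
            _ = δ * (n * μ B) := by ring
            _ ≤ δ * 1 := by gcongr
            _ = δ := mul_one δ

/-- A Rokhlin tower whose base has a prescribed measure. -/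
theorem exists_rokhlin_tower_measure_eq {X : Type*} [MeasurableSpace X] [StandardBorelSpace X]
    {μ : Measure X} [IsProbabilityMeasure μ]
    [NullSingletonClass μ] {τ : X ≃ᵐ X} (hτ : MeasurePreserving τ μ μ)
    (hper : ∀ n : ℕ, 1 ≤ n → μ {x | τ^[n] x = x} = 0) {N : ℕ} (hN : 0 < N) {δ : ENNReal}
    (hδ : δ ≠ 0) (hδ1 : δ ≤ 1) :
    ∃ E, MeasurableSet E ∧ μ E = (1 - δ) / N ∧
      Pairwise (Function.onFun Disjoint fun k : Fin N => τ.symm^[k] ⁻¹' E) ∧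
      μ (⋃ k : Fin N, τ.symm^[k] ⁻¹' E)ᶜ = δ := by
  have hN0 : (N : ENNReal) ≠ 0 := by exact_mod_cast hN.ne'
  have hpre : ∀ {E}, MeasurableSet E → ∀ k : ℕ, μ (τ.symm^[k] ⁻¹' E) = μ E := fun hE k =>
    ((hτ.symm τ).iterate k).measure_preimage hE.nullMeasurableSet
  obtain ⟨E₀, hE₀, hdisj, hcov⟩ := exists_rokhlin_tower hτ hper hN hδ
  have hle : (1 - δ) / N ≤ μ E₀ := by
    refine ENNReal.div_le_of_le_mul (tsub_le_iff_right.2 ?_)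
    calc (1 : ENNReal) = μ univ := measure_univ.symm
      _ ≤ μ (⋃ k : Fin N, τ.symm^[k] ⁻¹' E₀) + μ (⋃ k : Fin N, τ.symm^[k] ⁻¹' E₀)ᶜ :=
          measure_univ_le_add_compl _
      _ ≤ μ E₀ * N + δ := by
          gcongr
          refine (measure_iUnion_fintype_le _ _).trans ?_
          simp [hpre hE₀, mul_comm]
  obtain ⟨E, hEE, hE, hEm⟩ := exists_subset_measure_eq μ hE₀ hle
  have hpair : Pairwise (Function.onFun Disjoint fun k : Fin N => τ.symm^[k] ⁻¹' E) := by
    refine (pairwise_disjoint_on _).2 fun i j hij => Set.disjoint_left.2 fun x hi hj => ?_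
    have hij' : (i : ℕ) < j := hij
    refine hdisj _ (hEE hj) (j - i) (by omega) (by omega) ?_
    have e : τ^[(j - i : ℕ)] (τ.symm^[j] x) = τ.symm^[i] x := by
      conv_lhs => rw [show (j : ℕ) = (j - i) + i by omega, Function.iterate_add_apply,
        Nat.add_sub_cancel]
      exact Function.LeftInverse.iterate τ.right_inv _ _
    rw [e]
    exact hEE hi
  refine ⟨E, hE, hEm, hpair, ?_⟩
  have hm : ∀ k : Fin N, MeasurableSet (τ.symm^[k] ⁻¹' E) := fun k =>
    τ.symm.measurable.iterate k hE
  have hU : μ (⋃ k : Fin N, τ.symm^[k] ⁻¹' E) = 1 - δ := by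
    rw [measure_iUnion hpair hm, tsum_fintype]
    simp only [hpre hE, hEm, Finset.sum_const, Finset.card_univ, Fintype.card_fin, nsmul_eq_mul]
    exact ENNReal.mul_div_cancel hN0 (ENNReal.natCast_ne_top N)
  rw [prob_compl_eq_one_sub (.iUnion hm), hU, ENNReal.sub_sub_cancel ENNReal.one_ne_top hδ1]

end

/-- On an atomless standard probability space, any two aperiodic measure-preserving
automorphisms are conjugate up to arbitrarily small uniform distance: for every `ε > 0`
there is a measure-preserving automorphism `γ` such that
`μ {x | τ₁ x ≠ (γ⁻¹ ∘ τ₂ ∘ γ) x} ≤ ε`. -/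
theorem aperiodic_conjugacy_density {X : Type*} [MeasurableSpace X] [StandardBorelSpace X]
    (μ : Measure X) [IsProbabilityMeasure μ]
    (hAtomless : ∀ A : Set X, MeasurableSet A → 0 < μ A →
      ∃ B₁ B₂ : Set X, MeasurableSet B₁ ∧ MeasurableSet B₂ ∧ A = B₁ ∪ B₂ ∧
        Disjoint B₁ B₂ ∧ 0 < μ B₁ ∧ 0 < μ B₂)
    (τ₁ τ₂ : X ≃ᵐ X) (h₁ : MeasurePreserving τ₁ μ μ) (h₂ : MeasurePreserving τ₂ μ μ)
    (hAper₁ : ∀ n : ℕ, 1 ≤ n → μ {x | (⇑τ₁)^[n] x = x} = 0)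
    (hAper₂ : ∀ n : ℕ, 1 ≤ n → μ {x | (⇑τ₂)^[n] x = x} = 0)
    (ε : ℝ) (hε : 0 < ε) :
    ∃ γ : X ≃ᵐ X, MeasurePreserving γ μ μ ∧
      μ {x | τ₁ x ≠ γ.symm (τ₂ (γ x))} ≤ ENNReal.ofReal ε := by
  have : NullSingletonClass μ := ⟨fun x => by
    by_contra hx
    obtain ⟨B₁, B₂, -, -, hB, hd, hB₁, hB₂⟩ :=
      hAtomless {x} (measurableSet_singleton x) (pos_iff_ne_zero.2 hx)
    obtain ⟨y, hy⟩ := nonempty_of_measure_ne_zero hB₁.ne'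
    obtain ⟨z, hz⟩ := nonempty_of_measure_ne_zero hB₂.ne'
    have hy' : y ∈ ({x} : Set X) := hB ▸ .inl hy
    have hz' : z ∈ ({x} : Set X) := hB ▸ .inr hz
    rw [mem_singleton_iff] at hy' hz'
    exact Set.disjoint_left.1 hd hy (hy'.trans hz'.symm ▸ hz)⟩
  obtain ⟨δ, hδ, hδ1, hδε⟩ :
      ∃ δ : ENNReal, δ ≠ 0 ∧ δ < 1 ∧ δ + δ ≤ ENNReal.ofReal ε := by
    have hm : 0 < min (ε / 2) (1 / 2) := by positivity
    refine ⟨ENNReal.ofReal (min (ε / 2) (1 / 2)), by simpa using hm, ?_, ?_⟩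
    · rw [← ENNReal.ofReal_one]
      exact (ENNReal.ofReal_lt_ofReal_iff one_pos).2 ((min_le_right _ _).trans_lt (by norm_num))
    · rw [← ENNReal.ofReal_add hm.le hm.le]
      exact ENNReal.ofReal_le_ofReal (by linarith [min_le_left (ε / 2) (1 / 2)])
  obtain ⟨N, hNδ⟩ := ENNReal.exists_inv_nat_lt hδ
  have hN : 0 < N := Nat.pos_of_ne_zero fun h => by simp [h] at hNδ
  obtain ⟨E₁, hE₁, hE₁m, hd₁, hR₁⟩ := exists_rokhlin_tower_measure_eq h₁ hAper₁ hN hδ hδ1.le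
  obtain ⟨E₂, hE₂, hE₂m, hd₂, hR₂⟩ := exists_rokhlin_tower_measure_eq h₂ hAper₂ hN hδ hδ1.le
  have hP : ∀ {τ : X ≃ᵐ X} {E}, MeasurableSet E → ∀ k : Fin N,
      MeasurableSet (τ.symm^[k] ⁻¹' E) := fun {τ} _ hE k => τ.symm.measurable.iterate k hE
  set R₁ := (⋃ k : Fin N, τ₁.symm^[k] ⁻¹' E₁)ᶜ with hR₁def
  set R₂ := (⋃ k : Fin N, τ₂.symm^[k] ⁻¹' E₂)ᶜ with hR₂def
  have hR₁m : MeasurableSet R₁ := (MeasurableSet.iUnion (hP hE₁)).compl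
  have hR₂m : MeasurableSet R₂ := (MeasurableSet.iUnion (hP hE₂)).compl
  have hc0 : (1 - δ) / (N : ENNReal) ≠ 0 :=
    (ENNReal.div_pos (tsub_pos_of_lt hδ1).ne' (ENNReal.natCast_ne_top N)).ne'
  obtain ⟨f, g, hfg⟩ :=
    MeasureIsoOn.exists_of_measure_eq μ hE₁ hE₂ (hE₁m.trans hE₂m.symm) (hE₁m ▸ hc0)
  obtain ⟨r, s, hrs⟩ :=
    MeasureIsoOn.exists_of_measure_eq μ hR₁m hR₂m (hR₁.trans hR₂.symm) (hR₁.trans_ne hδ)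
  have hk : ∀ k : Fin N, MeasureIsoOn μ (τ₁.symm^[k] ⁻¹' E₁) (τ₂.symm^[k] ⁻¹' E₂)
      (τ₂^[k] ∘ f ∘ τ₁.symm^[k]) ((τ₁^[k] ∘ g) ∘ τ₂.symm^[k]) := fun k =>
    ((MeasureIsoOn.iterate_symm h₁ hE₁ k).trans hfg).trans
      ((MeasureIsoOn.iterate_symm h₂ hE₂ k).symm (hP hE₂ k))
  have hdisj : ∀ {P : Fin N → Set X} {R : Set X}, Pairwise (Function.onFun Disjoint P) →
      R = (⋃ k, P k)ᶜ →
      Pairwise (Function.onFun Disjoint fun o : Option (Fin N) => o.elim R P) := by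
    rintro P R hd rfl (_ | i) (_ | j) hij
    · exact absurd rfl hij
    · exact disjoint_compl_left.mono_right (subset_iUnion P j)
    · exact disjoint_compl_right.mono_left (subset_iUnion P i)
    · exact hd fun h => hij (congrArg some h)
  have hcover : ∀ {P : Fin N → Set X} {R : Set X}, R = (⋃ k, P k)ᶜ →
      ⋃ o : Option (Fin N), o.elim R P = univ := by
    rintro P R rfl
    rw [iUnion_option]
    exact compl_union_self _
  obtain ⟨F, G, hFG, hF⟩ := MeasureIsoOn.iUnion (μ := μ)
    (P := fun o : Option (Fin N) => o.elim R₁ fun k => τ₁.symm^[k] ⁻¹' E₁)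
    (Q := fun o : Option (Fin N) => o.elim R₂ fun k => τ₂.symm^[k] ⁻¹' E₂)
    (f := fun o => o.elim r fun k => τ₂^[k] ∘ f ∘ τ₁.symm^[k])
    (g := fun o => o.elim s fun k => (τ₁^[k] ∘ g) ∘ τ₂.symm^[k])
    (Option.forall.2 ⟨hR₁m, hP hE₁⟩) (Option.forall.2 ⟨hR₂m, hP hE₂⟩)
    (hdisj hd₁ hR₁def) (hdisj hd₂ hR₂def) (Option.forall.2 ⟨hrs, hk⟩)
  rw [hcover hR₁def, hcover hR₂def] at hFG
  let γ : X ≃ᵐ X :=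
    { toFun := F
      invFun := G
      left_inv := fun x => hFG.leftInvOn (mem_univ x)
      right_inv := fun x => hFG.rightInvOn (mem_univ x)
      measurable_toFun := hFG.measurable
      measurable_invFun := hFG.measurable_inv }
  have hmap : μ.map F = μ := by simpa only [Measure.restrict_univ] using hFG.map_restrict
  refine ⟨γ, ⟨hFG.measurable, hmap⟩, ?_⟩
  have hconj : ∀ (k : ℕ) (hk : k + 1 < N) (x), τ₁.symm^[k] x ∈ E₁ →
      τ₁ x = γ.symm (τ₂ (γ x)) := by
    intro k hk x hx
    have hx' : τ₁.symm^[k + 1] (τ₁ x) = τ₁.symm^[k] x := by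
      rw [Function.iterate_succ_apply, τ₁.symm_apply_apply]
    have e₁ : F x = τ₂^[k] (f (τ₁.symm^[k] x)) := hF (some ⟨k, by omega⟩) hx
    have e₂ : F (τ₁ x) = τ₂^[k + 1] (f (τ₁.symm^[k + 1] (τ₁ x))) :=
      hF (some ⟨k + 1, hk⟩) (show τ₁.symm^[k + 1] (τ₁ x) ∈ E₁ from hx' ▸ hx)
    refine (γ.eq_symm_apply).2 ?_
    show F (τ₁ x) = τ₂ (F x)
    rw [e₁, e₂, hx', Function.iterate_succ_apply']
  have hsub : {x | τ₁ x ≠ γ.symm (τ₂ (γ x))} ⊆ R₁ ∪ τ₁.symm^[N - 1] ⁻¹' E₁ := by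
    intro x hx
    by_cases hxR : x ∈ R₁
    · exact .inl hxR
    obtain ⟨k, hk⟩ := mem_iUnion.1 (not_notMem.1 hxR)
    right
    by_cases hkN : (k : ℕ) + 1 < N
    · exact absurd (hconj k hkN x hk) hx
    · rwa [show N - 1 = k by omega]
  calc μ {x | τ₁ x ≠ γ.symm (τ₂ (γ x))} ≤ μ R₁ + μ (τ₁.symm^[N - 1] ⁻¹' E₁) :=
        (measure_mono hsub).trans (measure_union_le _ _)
    _ = δ + (1 - δ) / N := by
        rw [hR₁, ((h₁.symm τ₁).iterate _).measure_preimage hE₁.nullMeasurableSet, hE₁m]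
    _ ≤ δ + δ := by
        gcongr
        calc (1 - δ) / (N : ENNReal) ≤ 1 / N := by gcongr; exact tsub_le_self
          _ ≤ δ := by rw [one_div]; exact hNδ.le
    _ ≤ ENNReal.ofReal ε := hδε
end

section
/- Let ([0,1], L, λ) be the unit interval with Lebesgue measure, n ∈ ℕ, and let τ, η be invertible measure-preserving transformations with τ^{n+1} = id and η^{n+1} = id almost everywhere, such that λ({x : τʲ(x) = x}) = 0 and λ({x : ηʲ(x) = x}) = 0 for all 1 ≤ j ≤ n. Then there exists an invertible measure-preserving transformation γ of [0,1] such that γ ∘ τ = η ∘ γ almost everywhere; that is, τ and η are conjugate. -/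
open MeasureTheory Set

section Gluing

/-- A conull set of injectivity can be shrunk to a measurable one with uncountable complement. -/
lemma exists_measurableSet_injOn_not_countable_compl {X Z : Type*} [MeasurableSpace X]
    {μ : Measure X} {Φ : X → Z}
    (hΦ : ∃ S ∈ ae μ, InjOn Φ S) (hX : ∃ L : Set X, μ L = 0 ∧ ¬ L.Countable) :
    ∃ S ∈ ae μ, MeasurableSet S ∧ InjOn Φ S ∧ ¬ Sᶜ.Countable := by
  obtain ⟨S, hS, hi⟩ := hΦ
  obtain ⟨L, hL, hLc⟩ := hX
  have h0 : μ (Sᶜ ∪ L) = 0 := measure_union_null hS hL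
  refine ⟨(toMeasurable μ (Sᶜ ∪ L))ᶜ, ?_, (measurableSet_toMeasurable _ _).compl, hi.mono ?_, ?_⟩
  · rw [mem_ae_iff, compl_compl, measure_toMeasurable, h0]
  · rw [compl_subset_comm]
    exact subset_union_left.trans (subset_toMeasurable _ _)
  · rw [compl_compl]
    exact fun h => hLc (h.mono (subset_union_right.trans (subset_toMeasurable _ _)))

variable {X Y Z : Type*} [MeasurableSpace X] [MeasurableSpace Y] [MeasurableSpace Z]

lemma MeasurableEmbedding.exists_measurableEquiv_of_range_eq {f : X → Z} {g : Y → Z}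
    (hf : MeasurableEmbedding f) (hg : MeasurableEmbedding g) (h : range f = range g) :
    ∃ e : X ≃ᵐ Y, ∀ x, g (e x) = f x := by
  have hu : ∀ x, ∃ y, g y = f x := fun x => h.subset (mem_range_self x)
  have hv : ∀ y, ∃ x, f x = g y := fun y => h.superset (mem_range_self y)
  choose u hu using hu
  choose v hv using hv
  refine ⟨⟨⟨u, v, fun x => hf.injective (by rw [hv, hu]), fun y => hg.injective (by rw [hu, hv])⟩,
    ?_, ?_⟩, hu⟩
  · exact hg.measurable_comp_iff.1 ((funext hu : g ∘ u = f) ▸ hf.measurable)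
  · exact hf.measurable_comp_iff.1 ((funext hv : f ∘ v = g) ▸ hg.measurable)

variable [StandardBorelSpace X] [StandardBorelSpace Y]

lemma MeasurableEquiv.exists_extend_of_not_countable_compl {S : Set X} {T : Set Y}
    (hS : MeasurableSet S) (hT : MeasurableSet T) (e : S ≃ᵐ T)
    (hSc : ¬ Sᶜ.Countable) (hTc : ¬ Tᶜ.Countable) :
    ∃ γ : X ≃ᵐ Y, ∀ x : S, γ x = e x := by
  classical
  have := hS.compl.standardBorel
  have := hT.compl.standardBorel
  let e' : (Sᶜ : Set X) ≃ᵐ (Tᶜ : Set Y) := PolishSpace.measurableEquivOfNotCountable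
    (by rwa [countable_coe_iff]) (by rwa [countable_coe_iff])
  refine ⟨((MeasurableEquiv.sumCompl hS).symm.trans (e.sumCongr e')).trans
    (MeasurableEquiv.sumCompl hT), fun x => ?_⟩
  have : (MeasurableEquiv.sumCompl hS).symm (x : X) = Sum.inl x := by
    rw [MeasurableEquiv.symm_apply_eq]; rfl
  simp only [MeasurableEquiv.trans_apply, this]
  rfl

/-- Two maps with the same law that are injective up to null sets differ by a measure-preserving
isomorphism. -/
lemma exists_measurePreserving_equiv_of_map_eq [MeasurableSpace.CountablySeparated Z]
    {μ : Measure X} {ν : Measure Y} {Φ : X → Z} {Ψ : Y → Z}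
    (hΦ : Measurable Φ) (hΨ : Measurable Ψ) (hmap : μ.map Φ = ν.map Ψ)
    (hΦi : ∃ S ∈ ae μ, InjOn Φ S) (hΨi : ∃ T ∈ ae ν, InjOn Ψ T)
    (hX : ∃ L : Set X, μ L = 0 ∧ ¬ L.Countable) (hY : ∃ M : Set Y, ν M = 0 ∧ ¬ M.Countable) :
    ∃ γ : X ≃ᵐ Y, MeasurePreserving γ μ ν ∧ ∀ᵐ x ∂μ, Ψ (γ x) = Φ x := by
  obtain ⟨S, hSμ, hS, hSi, hSc⟩ := exists_measurableSet_injOn_not_countable_compl hΦi hX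
  obtain ⟨T, hTν, hT, hTi, hTc⟩ := exists_measurableSet_injOn_not_countable_compl hΨi hY
  have hP : MeasurableSet (Φ '' S) := hS.image_of_measurable_injOn hΦ hSi
  have hQ : MeasurableSet (Ψ '' T) := hT.image_of_measurable_injOn hΨ hTi
  set S' := S ∩ Φ ⁻¹' (Ψ '' T)
  set T' := T ∩ Ψ ⁻¹' (Φ '' S)
  have hS' : MeasurableSet S' := hS.inter (hΦ hQ)
  have hT' : MeasurableSet T' := hT.inter (hΨ hP)
  have hS'μ : S' ∈ ae μ := by
    refine Filter.inter_mem hSμ ?_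
    refine (ae_map_iff hΦ.aemeasurable (p := (· ∈ Ψ '' T)) hQ).1 ?_
    rw [hmap]
    refine (ae_map_iff hΨ.aemeasurable (p := (· ∈ Ψ '' T)) hQ).2 ?_
    filter_upwards [hTν] with y hy using mem_image_of_mem _ hy
  have hT'ν : T' ∈ ae ν := by
    refine Filter.inter_mem hTν ?_
    refine (ae_map_iff hΨ.aemeasurable (p := (· ∈ Φ '' S)) hP).1 ?_
    rw [← hmap]
    refine (ae_map_iff hΦ.aemeasurable (p := (· ∈ Φ '' S)) hP).2 ?_
    filter_upwards [hSμ] with y hy using mem_image_of_mem _ hy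
  have := hS'.standardBorel
  have := hT'.standardBorel
  have hf : MeasurableEmbedding (S'.domRestrict Φ) :=
    (hΦ.comp measurable_subtype_coe).measurableEmbedding
      (injOn_iff_injective.1 (hSi.mono inter_subset_left))
  have hg : MeasurableEmbedding (T'.domRestrict Ψ) :=
    (hΨ.comp measurable_subtype_coe).measurableEmbedding
      (injOn_iff_injective.1 (hTi.mono inter_subset_left))
  have hr : range (S'.domRestrict Φ) = range (T'.domRestrict Ψ) := by
    rw [range_domRestrict, range_domRestrict, image_inter_preimage, image_inter_preimage, inter_comm]
  obtain ⟨e, he⟩ := hf.exists_measurableEquiv_of_range_eq hg hr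
  obtain ⟨γ, hγ⟩ := e.exists_extend_of_not_countable_compl hS' hT'
    (fun h => hSc (h.mono (compl_subset_compl.2 inter_subset_left)))
    (fun h => hTc (h.mono (compl_subset_compl.2 inter_subset_left)))
  have hγT : ∀ x ∈ S', γ x ∈ T' := fun x hx => by
    rw [hγ ⟨x, hx⟩]; exact (e ⟨x, hx⟩).2
  have hγΨ : ∀ x ∈ S', Ψ (γ x) = Φ x := fun x hx => by
    rw [hγ ⟨x, hx⟩]; exact he ⟨x, hx⟩
  refine ⟨γ, ⟨γ.measurable, Measure.ext fun s hs => ?_⟩,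
    by filter_upwards [hS'μ] with x hx using hγΨ x hx⟩
  have hW : MeasurableSet (Ψ '' (s ∩ T')) :=
    (hs.inter hT').image_of_measurable_injOn hΨ (hTi.mono fun y hy => hy.2.1)
  calc μ.map γ s = μ (γ ⁻¹' s) := Measure.map_apply γ.measurable hs
    _ = μ (Φ ⁻¹' (Ψ '' (s ∩ T'))) := measure_congr (by
        filter_upwards [hS'μ] with x hx
        refine propext ⟨fun h => ⟨γ x, ⟨h, hγT x hx⟩, hγΨ x hx⟩, ?_⟩
        rintro ⟨y, ⟨hys, hyT⟩, hy⟩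
        have : y = γ x := hTi hyT.1 (hγT x hx).1 (hy.trans (hγΨ x hx).symm)
        rwa [this] at hys)
    _ = ν (Ψ ⁻¹' (Ψ '' (s ∩ T'))) := by
        rw [← Measure.map_apply hΦ hW, hmap, Measure.map_apply hΨ hW]
    _ = ν s := measure_congr (by
        filter_upwards [hT'ν] with y hy
        refine propext ⟨?_, fun h => ⟨y, ⟨h, hy⟩, rfl⟩⟩
        rintro ⟨z, ⟨hzs, hzT⟩, hz⟩
        exact hTi hzT.1 hy.1 hz ▸ hzs)

end Gluing

lemma exists_null_not_countable_unitInterval :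
    ∃ L : Set (Icc (0:ℝ) 1), volume L = 0 ∧ ¬ L.Countable := by
  refine ⟨(↑) ⁻¹' {x : ℝ | Liouville x}, ?_, fun h => ?_⟩
  · have h := unitInterval.measurePreserving_coe.quasiMeasurePreserving.ae
      (ae_restrict_of_ae ae_not_liouville)
    simpa [ae_iff] using h
  · have hc : (((↑) : Icc (0:ℝ) 1 → ℝ) '' ((↑) ⁻¹' {x : ℝ | Liouville x})).Countable := h.image _
    have hm : (((↑) : Icc (0:ℝ) 1 → ℝ) '' ((↑) ⁻¹' {x : ℝ | Liouville x}))ᶜ ∈ residual ℝ := by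
      rw [← biUnion_of_singleton (Subtype.val '' (Subtype.val ⁻¹' _)), compl_iUnion₂]
      refine (countable_bInter_mem hc).2 fun x _ => ?_
      exact residual_of_dense_open isOpen_compl_singleton (dense_compl_singleton x)
    obtain ⟨x, ⟨hx1, hx2⟩, hx⟩ := (dense_of_mem_residual
      (Filter.inter_mem hm eventually_residual_liouville)).exists_mem_open
      (isOpen_Ioo (a := (0:ℝ)) (b := 1)) ⟨1/2, by norm_num, by norm_num⟩
    exact hx1 ⟨⟨x, hx.1.le, hx.2.le⟩, hx2, rfl⟩

/-- The distribution function of Lebesgue measure restricted to `A ⊆ [0,1]`. -/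
noncomputable def unitInterval.distr (A : Set (Icc (0:ℝ) 1)) (x : Icc (0:ℝ) 1) : ℝ :=
  volume.real (A ∩ Iic x)

namespace unitInterval

variable (A : Set (Icc (0:ℝ) 1))

lemma distr_nonneg (x : Icc (0:ℝ) 1) : 0 ≤ distr A x := measureReal_nonneg

lemma distr_mono : Monotone (distr A) := fun _ _ h =>
  measureReal_mono (inter_subset_inter_right _ (Iic_subset_Iic.2 h))

lemma continuous_distr : Continuous (distr A) := by
  have key : ∀ x y, x ≤ y → distr A y ≤ distr A x + dist x y := fun x y h => by
    have h1 : A ∩ Iic y ⊆ (A ∩ Iic x) ∪ Ioc x y := fun z hz => by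
      rcases le_or_gt z x with h | h
      · exact Or.inl ⟨hz.1, h⟩
      · exact Or.inr ⟨h, hz.2⟩
    refine (measureReal_mono h1).trans ((measureReal_union_le _ _).trans ?_)
    gcongr
    · exact le_rfl
    · rw [Measure.real, volume_Ioc, ENNReal.toReal_ofReal (sub_nonneg.2 h), dist_comm,
        Subtype.dist_eq, Real.dist_eq]
      exact le_abs_self _
  refine (LipschitzWith.of_le_add fun x y => ?_).continuous
  rcases le_total x y with h | h
  · exact (distr_mono A h).trans (le_add_of_nonneg_right dist_nonneg)
  · rw [dist_comm]; exact key y x h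

lemma map_distr :
    (volume.restrict A).map (distr A) = volume.restrict (Icc 0 (volume.real A)) := by
  have hm : Measurable (distr A) := (continuous_distr A).measurable
  have h0 : distr A 0 = 0 := by
    have : (volume : Measure (Icc (0:ℝ) 1)) (A ∩ Iic 0) = 0 :=
      measure_mono_null inter_subset_right (by rw [volume_Iic]; simp)
    simp [distr, Measure.real, this]
  have h1 : distr A 1 = volume.real A := by
    rw [distr, inter_eq_left.2]
    exact fun x _ => x.2.2
  refine Measure.ext_of_Iic _ _ fun c => ?_
  have hI : Iic c ∩ Icc 0 (volume.real A) = Icc 0 (min (volume.real A) c) := by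
    rw [inter_comm, ← Ici_inter_Iic, inter_assoc, Iic_inter_Iic, Ici_inter_Iic]
  rw [Measure.map_apply hm measurableSet_Iic, Measure.restrict_apply (hm measurableSet_Iic),
    Measure.restrict_apply measurableSet_Iic, hI, Real.volume_Icc,
    sub_zero, inter_comm]
  rcases lt_or_ge c 0 with hc | hc
  · rw [ENNReal.ofReal_of_nonpos ((min_le_right _ _).trans hc.le)]
    have : distr A ⁻¹' Iic c = ∅ := by
      ext x
      simpa using hc.trans_le (distr_nonneg A x)
    simp [this]
  · have hcl : IsClosed (distr A ⁻¹' Iic c) := isClosed_Iic.preimage (continuous_distr A)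
    obtain ⟨s, hs, hsmax⟩ := hcl.isCompact.exists_isGreatest ⟨0, by simpa [h0] using hc⟩
    have hset : distr A ⁻¹' Iic c = Iic s := by
      ext x
      exact ⟨fun hx => hsmax hx, fun hx => (distr_mono A hx).trans hs⟩
    rw [hset, ← ofReal_measureReal]
    congr 1
    change distr A s = _
    rcases le_or_gt (volume.real A) c with h | h
    · rw [min_eq_left h, ← h1]
      congr 1
      exact le_antisymm s.2.2 (hsmax (h1.trans_le h))
    · rw [min_eq_right h.le]
      obtain ⟨x, hx⟩ := mem_range_of_exists_le_of_exists_ge (continuous_distr A) ⟨0, h0 ▸ hc⟩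
        ⟨1, h1 ▸ h.le⟩
      exact le_antisymm hs (hx ▸ distr_mono A (hsmax hx.le))

lemma exists_null_injOn_distr (hA : MeasurableSet A) :
    ∃ N : Set (Icc (0:ℝ) 1), volume (A ∩ N) = 0 ∧ InjOn (distr A) Nᶜ := by
  obtain ⟨D, hDc, hD⟩ := TopologicalSpace.exists_countable_dense (Icc (0:ℝ) 1)
  refine ⟨⋃ q ∈ D, distr A ⁻¹' {distr A q}, ?_, ?_⟩
  · rw [inter_comm, ← Measure.restrict_apply₀']
    · refine (measure_biUnion_null_iff hDc).2 fun q _ => ?_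
      rw [← Measure.map_apply (continuous_distr A).measurable (measurableSet_singleton _),
        map_distr]
      simp
    · exact hA.nullMeasurableSet
  · have key : ∀ x ∈ (⋃ q ∈ D, distr A ⁻¹' {distr A q})ᶜ, ∀ y, x < y →
        distr A x ≠ distr A y := fun x hx y hxy h => by
      obtain ⟨q, hq, hxq, hqy⟩ := hD.exists_between hxy
      refine hx (mem_biUnion hq ?_)
      exact le_antisymm (distr_mono A hxq.le) (h ▸ distr_mono A hqy.le)
    intro x hx y hy h
    rcases lt_trichotomy x y with h' | h' | h'
    · exact absurd h (key x hx y h')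
    · exact h'
    · exact absurd h.symm (key y hy x h')

end unitInterval

section CyclicDomain

variable {X : Type*} [MeasurableSpace X]

/-- `A` meets almost every orbit of `f` exactly once, and the orbits through `A` have exactly
`n + 1` points. -/
structure IsCyclicDomain (μ : Measure X) (f : X → X) (n : ℕ) (A : Set X) : Prop where
  measurableSet : MeasurableSet A
  isPeriodicPt : ∀ x ∈ A, Function.IsPeriodicPt f (n + 1) x
  iterate_notMem : ∀ x ∈ A, ∀ j, 1 ≤ j → j ≤ n → f^[j] x ∉ A
  ae_exists_iterate_mem : ∀ᵐ x ∂μ, ∃ j ∈ Finset.range (n + 1), f^[j] x ∈ A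

/-- **Halmos's lemma** for periodic maps: the least points of the orbits of length `n + 1` form a
cyclic domain. -/
lemma exists_isCyclicDomain [TopologicalSpace X] [LinearOrder X] [OrderClosedTopology X]
    [SecondCountableTopology X] [BorelSpace X] {μ : Measure X} {f : X → X} {n : ℕ}
    (hf : Measurable f) (hinj : Function.Injective f) (hper : ∀ᵐ x ∂μ, f^[n + 1] x = x)
    (hfree : ∀ j : ℕ, 1 ≤ j → j ≤ n → μ {x | f^[j] x = x} = 0) :
    ∃ A, IsCyclicDomain μ f n A := by
  have hfree' : ∀ᵐ x ∂μ, ∀ j, 1 ≤ j → j ≤ n → f^[j] x ≠ x := by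
    rw [ae_all_iff]
    intro j
    by_cases h : 1 ≤ j ∧ j ≤ n
    · have := hfree j h.1 h.2
      filter_upwards [compl_mem_ae_iff.2 this] with x hx _ _ using hx
    · exact Filter.Eventually.of_forall fun x h1 h2 => absurd ⟨h1, h2⟩ h
  refine ⟨{x | f^[n + 1] x = x ∧ ∀ j, 1 ≤ j → j ≤ n → x < f^[j] x}, ?_, fun x hx => hx.1, ?_, ?_⟩
  · refine (measurableSet_eq_fun (hf.iterate _) measurable_id).inter ?_
    have : MeasurableSet (⋂ (j : ℕ) (_ : 1 ≤ j) (_ : j ≤ n), {x | x < f^[j] x}) :=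
      .iInter fun j => .iInter fun _ => .iInter fun _ =>
        measurableSet_lt measurable_id (hf.iterate j)
    refine (congrArg MeasurableSet (Set.ext fun x => ?_)).mp this
    simp only [mem_iInter]
    rfl
  · rintro x ⟨hx, hlt⟩ j h1 hn ⟨hx', hlt'⟩
    rcases Nat.lt_or_ge n (n + 1 - j) with h | h
    · omega
    have h2 := hlt' (n + 1 - j) (by omega) h
    rw [← Function.iterate_add_apply, Nat.sub_add_cancel (by omega), hx] at h2
    exact (hlt j h1 hn).asymm h2
  · filter_upwards [hper, hfree'] with x hx hne
    have hx : Function.IsPeriodicPt f (n + 1) x := hx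
    obtain ⟨j, hj, hmin⟩ := Finset.exists_min_image (Finset.range (n + 1)) (fun j => f^[j] x)
      ⟨0, by simp⟩
    refine ⟨j, hj, hx.apply_iterate j, fun i h1 hn => lt_of_le_of_ne ?_ fun h => ?_⟩
    · rw [← Function.iterate_add_apply, ← hx.iterate_mod_apply (i + j)]
      exact hmin _ (Finset.mem_range.2 (Nat.mod_lt _ n.succ_pos))
    · refine hne i h1 hn (hinj.iterate j ?_)
      rw [← Function.iterate_add_apply, add_comm, Function.iterate_add_apply, ← h]

namespace IsCyclicDomain

variable {μ : Measure X} {f : X → X} {n : ℕ} {A : Set X}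

lemma iterate_mem_iff (h : IsCyclicDomain μ f n A) {x : X} (hx : x ∈ A) (k : ℕ) :
    f^[k] x ∈ A ↔ (n + 1) ∣ k := by
  have hlt := Nat.mod_lt k n.succ_pos
  rw [← (h.isPeriodicPt x hx).iterate_mod_apply, Nat.dvd_iff_mod_eq_zero]
  refine ⟨fun hk => ?_, fun hk => by rwa [hk]⟩
  by_contra h0
  exact h.iterate_notMem x hx _ (Nat.pos_of_ne_zero h0) (Nat.lt_succ_iff.1 hlt) hk

lemma eq_sum_map (h : IsCyclicDomain μ f n A) (hf : MeasurePreserving f μ μ)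
    (hinj : Function.Injective f) :
    μ = ∑ j ∈ Finset.range (n + 1), (μ.restrict A).map f^[n + 1 - j] := by
  ext s hs
  have hD : ∀ j, MeasurableSet (s ∩ f^[j] ⁻¹' A) := fun j =>
    hs.inter (hf.measurable.iterate j h.measurableSet)
  have hdisj : (Finset.range (n + 1) : Set ℕ).PairwiseDisjoint fun j => s ∩ f^[j] ⁻¹' A := by
    have key : ∀ i j, i < j → j < n + 1 → ∀ x, f^[i] x ∈ A → f^[j] x ∉ A := by
      intro i j hij hj x hi
      have := h.iterate_notMem _ hi (j - i) (by omega) (by omega)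
      rwa [← Function.iterate_add_apply, Nat.sub_add_cancel hij.le] at this
    intro i hi j hj hij
    have hi := Finset.mem_range.1 hi
    have hj := Finset.mem_range.1 hj
    refine disjoint_left.2 fun x hxi hxj => ?_
    rcases hij.lt_or_gt with hlt | hlt
    · exact key i j hlt hj x hxi.2 hxj.2
    · exact key j i hlt hi x hxj.2 hxi.2
  calc μ s = μ (⋃ j ∈ Finset.range (n + 1), s ∩ f^[j] ⁻¹' A) := measure_congr (by
        filter_upwards [h.ae_exists_iterate_mem] with x ⟨j, hj, hx⟩
        refine propext ⟨fun hxs => mem_biUnion hj ⟨hxs, hx⟩, fun hxs => ?_⟩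
        obtain ⟨_, _, hxs, _⟩ := mem_iUnion₂.1 hxs
        exact hxs)
    _ = ∑ j ∈ Finset.range (n + 1), μ (s ∩ f^[j] ⁻¹' A) :=
        measure_biUnion_finset hdisj fun j _ => hD j
    _ = _ := by
        rw [Measure.finsetSum_apply]
        refine Finset.sum_congr rfl fun j hj => ?_
        have hj := Finset.mem_range.1 hj
        have hm := hf.measurable.iterate (n + 1 - j)
        rw [Measure.map_apply hm hs, Measure.restrict_apply (hm hs),
          ← (hf.iterate (n + 1 - j)).measure_preimage (hD j).nullMeasurableSet]
        congr 1
        ext x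
        have hx : f^[j] (f^[n + 1 - j] x) = f^[n + 1] x := by
          rw [← Function.iterate_add_apply, Nat.add_sub_cancel' hj.le]
        refine and_congr_right fun _ => ?_
        rw [mem_preimage, hx]
        refine ⟨fun hA => ?_, fun hA => (h.isPeriodicPt x hA).symm ▸ hA⟩
        rwa [hinj.iterate (n + 1) (h.isPeriodicPt _ hA)] at hA

lemma mul_measureReal [IsProbabilityMeasure μ] (h : IsCyclicDomain μ f n A)
    (hf : MeasurePreserving f μ μ) (hinj : Function.Injective f) :
    (n + 1) * μ.real A = 1 := by
  have h1 := congrArg (fun ρ : Measure X => ρ univ) (h.eq_sum_map hf hinj)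
  have h2 : ∀ j ∈ Finset.range (n + 1),
      (μ.restrict A).map f^[n + 1 - j] univ = μ A := fun j _ => by
    rw [Measure.map_apply (hf.measurable.iterate _) MeasurableSet.univ, preimage_univ,
      Measure.restrict_apply_univ]
  simp only [measure_univ, Measure.finsetSum_apply, Finset.sum_congr rfl h2, Finset.sum_const,
    Finset.card_range, nsmul_eq_mul] at h1
  have h3 := congrArg ENNReal.toReal h1
  rw [ENNReal.toReal_mul, ENNReal.toReal_natCast, ENNReal.toReal_one, Nat.cast_add_one] at h3
  exact h3.symm

end IsCyclicDomain

/-- The itinerary of a point: the values of `1 + g` at the visits of its orbit to `A`, and `0` at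
all other times. -/
noncomputable def itinerary (f : X → X) (A : Set X) (g : X → ℝ) (x : X) (k : ℕ) : ℝ :=
  A.indicator (fun y => 1 + g y) (f^[k] x)

/-- The sequence equal to `1 + t` at the multiples of `n + 1` and to `0` elsewhere. -/
noncomputable def periodicSpike (n : ℕ) (t : ℝ) (k : ℕ) : ℝ :=
  if (n + 1) ∣ k then 1 + t else 0

lemma measurable_periodicSpike (n : ℕ) : Measurable (periodicSpike n) := by
  refine measurable_pi_lambda _ fun k => ?_
  unfold periodicSpike
  split_ifs <;> fun_prop

namespace IsCyclicDomain

variable {μ : Measure X} {f : X → X} {n : ℕ} {A : Set X} {g : X → ℝ}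

lemma measurable_itinerary (h : IsCyclicDomain μ f n A) (hf : Measurable f) (hg : Measurable g) :
    Measurable (itinerary f A g) :=
  measurable_pi_lambda _ fun k =>
    ((measurable_const.add hg).indicator h.measurableSet).comp (hf.iterate k)

lemma map_itinerary (h : IsCyclicDomain μ f n A) (hf : MeasurePreserving f μ μ)
    (hinj : Function.Injective f) (hg : Measurable g) :
    μ.map (itinerary f A g) = ∑ j ∈ Finset.range (n + 1),
      (((μ.restrict A).map g).map (periodicSpike n)).map fun z k => z (k + (n + 1 - j)) := by
  have hm := h.measurable_itinerary hf.measurable hg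
  have hι := measurable_periodicSpike n
  conv_lhs => rw [h.eq_sum_map hf hinj]
  rw [Measure.map_finset_sum hm.aemeasurable]
  refine Finset.sum_congr rfl fun j _ => ?_
  have hσ : Measurable fun (z : ℕ → ℝ) k => z (k + (n + 1 - j)) := by fun_prop
  rw [Measure.map_map hm (hf.measurable.iterate _), Measure.map_map hι hg,
    Measure.map_map hσ (hι.comp hg)]
  refine Measure.map_congr ?_
  filter_upwards [ae_restrict_mem h.measurableSet] with x hx
  ext k
  simp only [Function.comp_apply, itinerary, periodicSpike, ← Function.iterate_add_apply]
  by_cases hk : n + 1 ∣ k + (n + 1 - j)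
  · rw [indicator_of_mem ((h.iterate_mem_iff hx _).2 hk), if_pos hk,
      ← (h.isPeriodicPt x hx).iterate_mod_apply, Nat.dvd_iff_mod_eq_zero.1 hk]
    rfl
  · rw [indicator_of_notMem (mt (h.iterate_mem_iff hx _).1 hk), if_neg hk]

lemma exists_injOn_itinerary (h : IsCyclicDomain μ f n A) (hf : MeasurePreserving f μ μ)
    (hinj : Function.Injective f) (hg : ∀ x, 0 ≤ g x)
    (hN : ∃ N, μ (A ∩ N) = 0 ∧ InjOn g Nᶜ) :
    ∃ S ∈ ae μ, InjOn (itinerary f A g) S := by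
  obtain ⟨N, hN, hgi⟩ := hN
  refine ⟨{x | (∃ j ∈ Finset.range (n + 1), f^[j] x ∈ A) ∧ ∀ k, f^[k] x ∉ A ∩ N}, ?_, ?_⟩
  · have hk : ∀ᵐ x ∂μ, ∀ k, f^[k] x ∉ A ∩ N := ae_all_iff.2 fun k =>
      (hf.iterate k).quasiMeasurePreserving.ae (compl_mem_ae_iff.2 hN)
    filter_upwards [h.ae_exists_iterate_mem, hk] with x h1 h2 using ⟨h1, h2⟩
  · rintro x ⟨⟨k, -, hxA⟩, hxN⟩ y ⟨-, hyN⟩ hxy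
    have hk : itinerary f A g x k = itinerary f A g y k := congrFun hxy k
    simp only [itinerary, indicator_of_mem hxA] at hk
    have hyA : f^[k] y ∈ A := by
      by_contra hyA
      rw [indicator_of_notMem hyA] at hk
      linarith [hg (f^[k] x)]
    rw [indicator_of_mem hyA] at hk
    exact hinj.iterate k (hgi (fun hx => hxN k ⟨hxA, hx⟩) (fun hy => hyN k ⟨hyA, hy⟩)
      (add_left_cancel hk))

end IsCyclicDomain

end CyclicDomain

/-- On the unit interval with Lebesgue measure, any two invertible measure-preserving
transformations `τ, η` with `τ^{n+1} = id` and `η^{n+1} = id` a.e. and with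
`λ {x : τʲ x = x} = 0 = λ {x : ηʲ x = x}` for all `1 ≤ j ≤ n` are conjugate:
there is an invertible measure-preserving `γ` with `γ ∘ τ = η ∘ γ` a.e. -/
theorem periodic_fixedPointFree_conjugate (n : ℕ)
    (τ η : Set.Icc (0:ℝ) 1 ≃ᵐ Set.Icc (0:ℝ) 1)
    (hτ : MeasurePreserving τ (volume : Measure (Set.Icc (0:ℝ) 1)) volume)
    (hη : MeasurePreserving η (volume : Measure (Set.Icc (0:ℝ) 1)) volume)
    (hτper : ∀ᵐ x ∂(volume : Measure (Set.Icc (0:ℝ) 1)), (⇑τ)^[n + 1] x = x)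
    (hηper : ∀ᵐ x ∂(volume : Measure (Set.Icc (0:ℝ) 1)), (⇑η)^[n + 1] x = x)
    (hτfree : ∀ j : ℕ, 1 ≤ j → j ≤ n →
      (volume : Measure (Set.Icc (0:ℝ) 1)) {x | (⇑τ)^[j] x = x} = 0)
    (hηfree : ∀ j : ℕ, 1 ≤ j → j ≤ n →
      (volume : Measure (Set.Icc (0:ℝ) 1)) {x | (⇑η)^[j] x = x} = 0) :
    ∃ γ : Set.Icc (0:ℝ) 1 ≃ᵐ Set.Icc (0:ℝ) 1,
      MeasurePreserving γ (volume : Measure (Set.Icc (0:ℝ) 1)) volume ∧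
      ∀ᵐ x ∂(volume : Measure (Set.Icc (0:ℝ) 1)), γ (τ x) = η (γ x) := by
  obtain ⟨A, hA⟩ := exists_isCyclicDomain τ.measurable τ.injective hτper hτfree
  obtain ⟨B, hB⟩ := exists_isCyclicDomain η.measurable η.injective hηper hηfree
  have hAB : volume.real A = volume.real B := mul_left_cancel₀ (n.cast_add_one_ne_zero (R := ℝ))
    ((hA.mul_measureReal hτ τ.injective).trans (hB.mul_measureReal hη η.injective).symm)
  have hmA := (unitInterval.continuous_distr A).measurable
  have hmB := (unitInterval.continuous_distr B).measurable
  have hBi := hB.exists_injOn_itinerary hη η.injective (unitInterval.distr_nonneg B)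
    (unitInterval.exists_null_injOn_distr B hB.measurableSet)
  obtain ⟨γ, hγ, hγΨ⟩ := exists_measurePreserving_equiv_of_map_eq
    (hA.measurable_itinerary τ.measurable hmA) (hB.measurable_itinerary η.measurable hmB)
    (by rw [hA.map_itinerary hτ τ.injective hmA, hB.map_itinerary hη η.injective hmB,
      unitInterval.map_distr, unitInterval.map_distr, hAB])
    (hA.exists_injOn_itinerary hτ τ.injective (unitInterval.distr_nonneg A)
      (unitInterval.exists_null_injOn_distr A hA.measurableSet))
    hBi exists_null_not_countable_unitInterval exists_null_not_countable_unitInterval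
  refine ⟨γ, hγ, ?_⟩
  obtain ⟨S, hS, hSi⟩ := hBi
  filter_upwards [hγΨ, hτ.quasiMeasurePreserving.ae hγΨ,
    (hγ.comp hτ).quasiMeasurePreserving.ae hS, (hη.comp hγ).quasiMeasurePreserving.ae hS]
    with x h1 h2 h3 h4
  refine hSi h3 h4 (h2.trans (funext fun k => ?_))
  exact (congrFun h1 (k + 1)).symm
end
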